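/- Let ℏ > 0, let H₁, H₂ : ℝ → M be continuously differentiable families of Hermitian D×D complex matrices, and let ψ₁, ψ₂ : ℝ → ℂ^D be twice differentiable with iℏ ψ_k'(t) = H_k(t) ψ_k(t) and common initial condition ψ₁(0) = ψ₂(0) = ψ₀, where ψ₀ is a unit vector. Set ρ(t) = (1/2)(|ψ₁(t)⟩⟨ψ₁(t)| + |ψ₂(t)⟩⟨ψ₂(t)|). Then the second derivative of t ↦ Tr(ρ(t)²) at t = 0 equals ℏ⁻² ( ⟨ψ₀, (H₁(0) − H₂(0)) ψ₀⟩² − ⟨ψ₀, (H₁(0) − H₂(0))² ψ₀⟩ ); in particular it is ≤ 0. -/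

import Mathlib

open Matrix
open scoped InnerProductSpace ComplexOrder

section Auxiliary

variable {E : Type*} [NormedAddCommGroup E] [InnerProductSpace ℂ E] [NormedSpace ℝ E]

/-- Differentiating `⟪ψ, ψ'⟫ + ⟪ψ', ψ⟫ = 0` (conservation of the norm) once more. -/
lemma inner_deriv2_add_of_norm_conserved {ψ ψ' : ℝ → E} {ψ'' : E} {t : ℝ}
    (hd : HasDerivAt ψ (ψ' t) t) (hdd : HasDerivAt ψ' ψ'' t)
    (h : ∀ s, ⟪ψ s, ψ' s⟫_ℂ + ⟪ψ' s, ψ s⟫_ℂ = 0) :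
    ⟪ψ t, ψ''⟫_ℂ + ⟪ψ'', ψ t⟫_ℂ = -2 * ⟪ψ' t, ψ' t⟫_ℂ := by
  have h₁ := (hd.inner ℂ hdd).add (hdd.inner ℂ hd)
  have h₂ : HasDerivAt (fun s => ⟪ψ s, ψ' s⟫_ℂ + ⟪ψ' s, ψ s⟫_ℂ) 0 t := by
    simpa only [h] using hasDerivAt_const t (0 : ℂ)
  linear_combination h₁.unique h₂

/-- The second derivative of `t ↦ (N₁² + N₂² + 2 ⟪ψ₁, ψ₂⟫ ⟪ψ₂, ψ₁⟫) / 4`, where `N_k = ⟪ψ_k, ψ_k⟫`,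
for two norm-conserving curves that agree at `0`. -/
lemma hasDerivAt_deriv_overlap {ψ₁ ψ₁' ψ₁'' ψ₂ ψ₂' ψ₂'' : ℝ → E}
    (h₁ : ∀ t, HasDerivAt ψ₁ (ψ₁' t) t) (h₁' : ∀ t, HasDerivAt ψ₁' (ψ₁'' t) t)
    (h₂ : ∀ t, HasDerivAt ψ₂ (ψ₂' t) t) (h₂' : ∀ t, HasDerivAt ψ₂' (ψ₂'' t) t)
    (c₁ : ∀ t, ⟪ψ₁ t, ψ₁' t⟫_ℂ + ⟪ψ₁' t, ψ₁ t⟫_ℂ = 0)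
    (c₂ : ∀ t, ⟪ψ₂ t, ψ₂' t⟫_ℂ + ⟪ψ₂' t, ψ₂ t⟫_ℂ = 0)
    {ψ₀ : E} (hψ₀ : ‖ψ₀‖ = 1) (i₁ : ψ₁ 0 = ψ₀) (i₂ : ψ₂ 0 = ψ₀) :
    HasDerivAt (deriv fun t => (4 : ℂ)⁻¹ * (⟪ψ₁ t, ψ₁ t⟫_ℂ * ⟪ψ₁ t, ψ₁ t⟫_ℂ
        + ⟪ψ₂ t, ψ₂ t⟫_ℂ * ⟪ψ₂ t, ψ₂ t⟫_ℂ + 2 * (⟪ψ₁ t, ψ₂ t⟫_ℂ * ⟪ψ₂ t, ψ₁ t⟫_ℂ)))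
      (-⟪ψ₁' 0 - ψ₂' 0, ψ₁' 0 - ψ₂' 0⟫_ℂ - ⟪ψ₀, ψ₁' 0 - ψ₂' 0⟫_ℂ ^ 2) 0 := by
  have hderiv : (deriv fun t => (4 : ℂ)⁻¹ * (⟪ψ₁ t, ψ₁ t⟫_ℂ * ⟪ψ₁ t, ψ₁ t⟫_ℂ
        + ⟪ψ₂ t, ψ₂ t⟫_ℂ * ⟪ψ₂ t, ψ₂ t⟫_ℂ + 2 * (⟪ψ₁ t, ψ₂ t⟫_ℂ * ⟪ψ₂ t, ψ₁ t⟫_ℂ))) =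
      fun t => (2 : ℂ)⁻¹ * ((⟪ψ₁ t, ψ₂' t⟫_ℂ + ⟪ψ₁' t, ψ₂ t⟫_ℂ) * ⟪ψ₂ t, ψ₁ t⟫_ℂ
        + ⟪ψ₁ t, ψ₂ t⟫_ℂ * (⟪ψ₂ t, ψ₁' t⟫_ℂ + ⟪ψ₂' t, ψ₁ t⟫_ℂ)) := by
    funext t
    have n₁ := (h₁ t).inner ℂ (h₁ t)
    have n₂ := (h₂ t).inner ℂ (h₂ t)
    have o := ((h₁ t).inner ℂ (h₂ t)).mul ((h₂ t).inner ℂ (h₁ t))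
    refine (((((n₁.mul n₁).add (n₂.mul n₂)).add (o.const_mul 2)).const_mul
      (4 : ℂ)⁻¹).congr_deriv ?_).deriv
    rw [c₁, c₂]
    ring
  rw [hderiv]
  have f' := ((h₁ 0).inner ℂ (h₂' 0)).add ((h₁' 0).inner ℂ (h₂ 0))
  have g' := ((h₂ 0).inner ℂ (h₁' 0)).add ((h₂' 0).inner ℂ (h₁ 0))
  refine (((f'.mul ((h₂ 0).inner ℂ (h₁ 0))).add
    (((h₁ 0).inner ℂ (h₂ 0)).mul g')).const_mul (2 : ℂ)⁻¹).congr_deriv ?_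
  have d₁ := inner_deriv2_add_of_norm_conserved (h₁ 0) (h₁' 0) c₁
  have d₂ := inner_deriv2_add_of_norm_conserved (h₂ 0) (h₂' 0) c₂
  have e₁ := c₁ 0
  have e₂ := c₂ 0
  have hn : ⟪ψ₀, ψ₀⟫_ℂ = 1 := by rw [inner_self_eq_norm_sq_to_K, hψ₀]; simp
  simp only [Pi.add_apply, i₁, i₂, hn, inner_sub_left, inner_sub_right] at *
  rw [eq_neg_of_add_eq_zero_right e₁, eq_neg_of_add_eq_zero_right e₂]
  linear_combination (2 : ℂ)⁻¹ * d₁ + (2 : ℂ)⁻¹ * d₂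

end Auxiliary

/-- The purity of the equal mixture of two pure states in terms of their overlaps. -/
lemma trace_sq_equal_mixture {ι : Type*} [Fintype ι] [DecidableEq ι] (x y : EuclideanSpace ℂ ι) :
    (((2 : ℂ)⁻¹ • (Matrix.of fun i j => x i * starRingEnd ℂ (x j))
      + (2 : ℂ)⁻¹ • (Matrix.of fun i j => y i * starRingEnd ℂ (y j))) ^ 2).trace =
    (4 : ℂ)⁻¹ * (⟪x, x⟫_ℂ * ⟪x, x⟫_ℂ + ⟪y, y⟫_ℂ * ⟪y, y⟫_ℂ + 2 * (⟪x, y⟫_ℂ * ⟪y, x⟫_ℂ)) := by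
  have key (u v : EuclideanSpace ℂ ι) :
      ((Matrix.of fun i j => u i * starRingEnd ℂ (u j)) *
        (Matrix.of fun i j => v i * starRingEnd ℂ (v j))).trace = ⟪u, v⟫_ℂ * ⟪v, u⟫_ℂ := by
    simp only [Matrix.trace, Matrix.diag, Matrix.mul_apply, Matrix.of_apply, PiLp.inner_apply,
      RCLike.inner_apply]
    rw [mul_comm, Finset.sum_mul_sum]
    exact Finset.sum_congr rfl fun i _ => Finset.sum_congr rfl fun j _ => by ring
  simp only [pow_two, add_mul, mul_add, Matrix.trace_add, smul_mul_assoc, mul_smul_comm,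
    Matrix.trace_smul, key, smul_eq_mul]
  ring

/-- A solution of the Schrödinger equation conserves the norm. -/
lemma inner_add_inner_eq_zero_of_schrodinger {E : Type*} [NormedAddCommGroup E]
    [InnerProductSpace ℂ E] {ℏ : ℝ} (hℏ : ℏ ≠ 0) {T : E →ₗ[ℂ] E} (hT : T.IsSymmetric) {v w : E}
    (h : (Complex.I * (ℏ : ℂ)) • w = T v) : ⟪v, w⟫_ℂ + ⟪w, v⟫_ℂ = 0 := by
  have hc : Complex.I * (ℏ : ℂ) ≠ 0 := by simp [hℏ]
  have hs := hT v v
  rw [← h, inner_smul_left, inner_smul_right] at hs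
  simp only [map_mul, Complex.conj_I, Complex.conj_ofReal] at hs
  refine mul_left_cancel₀ hc ?_
  linear_combination -hs

/-- For a unit vector, the square of a real expectation value is at most the second moment. -/
lemma inner_sq_le_inner_self_of_isSymmetric {E : Type*} [NormedAddCommGroup E]
    [InnerProductSpace ℂ E] {T : E →ₗ[ℂ] E} (hT : T.IsSymmetric) {v : E} (hv : ‖v‖ = 1) :
    ⟪v, T v⟫_ℂ ^ 2 ≤ ⟪T v, T v⟫_ℂ := by
  have hre : ((⟪v, T v⟫_ℂ).re : ℂ) = ⟪v, T v⟫_ℂ := by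
    rw [← Complex.conj_eq_iff_re, inner_conj_symm, hT]
  rw [← hre, inner_self_eq_norm_sq_to_K]
  have hb : |(⟪v, T v⟫_ℂ).re| ≤ ‖T v‖ :=
    (Complex.abs_re_le_norm _).trans ((norm_inner_le_norm _ _).trans_eq (by rw [hv, one_mul]))
  have h := Complex.real_le_real.mpr (sq_le_sq' (abs_le.mp hb).1 (abs_le.mp hb).2)
  push_cast at h
  exact h

/-- **Second derivative of the purity for an ensemble of two Ehrenfest trajectories.**
Let `ℏ > 0`, let `H₁, H₂` be continuously differentiable families of Hermitian `D × D`
complex matrices, and let `ψ₁, ψ₂ : ℝ → ℂ^D` be twice differentiable solutions of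
`iℏ ψ_k'(t) = H_k(t) ψ_k(t)` with common initial condition `ψ₀`, a unit vector.  With
`ρ t = (1/2)(|ψ₁ t⟩⟨ψ₁ t| + |ψ₂ t⟩⟨ψ₂ t|)`, the second derivative of the purity
`t ↦ Tr(ρ(t)²)` at `t = 0` equals
`ℏ⁻² (⟨ψ₀, (H₁(0) − H₂(0)) ψ₀⟩² − ⟨ψ₀, (H₁(0) − H₂(0))² ψ₀⟩)`;
in particular it is `≤ 0`. -/
theorem ehrenfest_two_trajectories_purity_second_deriv (D : ℕ) (ℏ : ℝ) (hℏ : 0 < ℏ)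
    (H₁ H₂ : ℝ → Matrix (Fin D) (Fin D) ℂ)
    (hH₁herm : ∀ t, (H₁ t).IsHermitian) (hH₂herm : ∀ t, (H₂ t).IsHermitian)
    (hH₁cd : ∀ i j, ContDiff ℝ 1 fun t => H₁ t i j)
    (hH₂cd : ∀ i j, ContDiff ℝ 1 fun t => H₂ t i j)
    (ψ₁ ψ₁' ψ₁'' ψ₂ ψ₂' ψ₂'' : ℝ → EuclideanSpace ℂ (Fin D))
    (hψ₁d : ∀ t, HasDerivAt ψ₁ (ψ₁' t) t) (hψ₁dd : ∀ t, HasDerivAt ψ₁' (ψ₁'' t) t)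
    (hψ₂d : ∀ t, HasDerivAt ψ₂ (ψ₂' t) t) (hψ₂dd : ∀ t, HasDerivAt ψ₂' (ψ₂'' t) t)
    (hSchr₁ : ∀ t, (Complex.I * (ℏ : ℂ)) • ψ₁' t = Matrix.toEuclideanLin (H₁ t) (ψ₁ t))
    (hSchr₂ : ∀ t, (Complex.I * (ℏ : ℂ)) • ψ₂' t = Matrix.toEuclideanLin (H₂ t) (ψ₂ t))
    (ψ₀ : EuclideanSpace ℂ (Fin D)) (hψ₀ : ‖ψ₀‖ = 1)
    (hinit₁ : ψ₁ 0 = ψ₀) (hinit₂ : ψ₂ 0 = ψ₀)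
    (ρ : ℝ → Matrix (Fin D) (Fin D) ℂ)
    (hρ : ∀ t, ρ t = (2 : ℂ)⁻¹ • (Matrix.of fun i j =>
        ψ₁ t i * starRingEnd ℂ (ψ₁ t j)) + (2 : ℂ)⁻¹ • (Matrix.of fun i j =>
        ψ₂ t i * starRingEnd ℂ (ψ₂ t j))) :
    HasDerivAt (deriv fun t => (ρ t ^ 2).trace)
        (((ℏ : ℂ) ^ 2)⁻¹ *
          (⟪ψ₀, Matrix.toEuclideanLin (H₁ 0 - H₂ 0) ψ₀⟫_ℂ ^ 2 -
            ⟪ψ₀, Matrix.toEuclideanLin ((H₁ 0 - H₂ 0) * (H₁ 0 - H₂ 0)) ψ₀⟫_ℂ)) 0 ∧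
      ((ℏ : ℂ) ^ 2)⁻¹ *
          (⟪ψ₀, Matrix.toEuclideanLin (H₁ 0 - H₂ 0) ψ₀⟫_ℂ ^ 2 -
            ⟪ψ₀, Matrix.toEuclideanLin ((H₁ 0 - H₂ 0) * (H₁ 0 - H₂ 0)) ψ₀⟫_ℂ) ≤ 0 := by
  have hℏ₀ : ℏ ≠ 0 := hℏ.ne'
  have hc : (ℏ : ℂ) ≠ 0 := by exact_mod_cast hℏ₀
  have sym {A : Matrix (Fin D) (Fin D) ℂ} (hA : A.IsHermitian) :
      (Matrix.toEuclideanLin A).IsSymmetric := Matrix.isSymmetric_toEuclideanLin_iff.mpr hA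
  have symΔ := sym ((hH₁herm 0).sub (hH₂herm 0))
  have hsq : ⟪ψ₀, Matrix.toEuclideanLin ((H₁ 0 - H₂ 0) * (H₁ 0 - H₂ 0)) ψ₀⟫_ℂ =
      ⟪Matrix.toEuclideanLin (H₁ 0 - H₂ 0) ψ₀, Matrix.toEuclideanLin (H₁ 0 - H₂ 0) ψ₀⟫_ℂ := by
    rw [symΔ]
    simp only [Matrix.toLpLin_apply, Matrix.mulVec_mulVec]
  rw [hsq]
  refine ⟨?_, ?_⟩
  · have hΔ : Matrix.toEuclideanLin (H₁ 0 - H₂ 0) ψ₀ = (Complex.I * (ℏ : ℂ)) • (ψ₁' 0 - ψ₂' 0) := by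
      rw [smul_sub, hSchr₁, hSchr₂, hinit₁, hinit₂, map_sub, LinearMap.sub_apply]
    simp only [hρ, trace_sq_equal_mixture]
    refine (hasDerivAt_deriv_overlap hψ₁d hψ₁dd hψ₂d hψ₂dd
      (fun t => inner_add_inner_eq_zero_of_schrodinger hℏ₀ (sym (hH₁herm t)) (hSchr₁ t))
      (fun t => inner_add_inner_eq_zero_of_schrodinger hℏ₀ (sym (hH₂herm t)) (hSchr₂ t))
      hψ₀ hinit₁ hinit₂).congr_deriv ?_
    rw [hΔ, inner_smul_right, inner_smul_left, inner_smul_right, map_mul, Complex.conj_I,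
      Complex.conj_ofReal]
    field_simp
    linear_combination (-(⟪ψ₁' 0 - ψ₂' 0, ψ₁' 0 - ψ₂' 0⟫_ℂ + ⟪ψ₀, ψ₁' 0 - ψ₂' 0⟫_ℂ ^ 2)) *
      Complex.I_sq
  · refine mul_nonpos_of_nonneg_of_nonpos ?_
      (sub_nonpos.mpr (inner_sq_le_inner_self_of_isSymmetric symΔ hψ₀))
    exact_mod_cast inv_nonneg.mpr (sq_nonneg ℏ)
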